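/- Let V be the electrostatic potential of eight unit point charges placed at the vertices (±1, ±1, ±1) of a cube in ℝ³. Then for each of the twelve edge midpoints m of the cube (the points with exactly one coordinate equal to 0 and the other two coordinates in {−1, 1}), there exists t ∈ (1/2, 1) such that ∇V(t·m) = 0. In particular, besides the equilibrium at the center, V has at least twelve equilibria, one on each open segment joining the cube's center to the midpoint of one of its edges. -/

import Mathlib

noncomputable section

open Finset

abbrev E3 := EuclideanSpace ℝ (Fin 3)

/-- The point `(a, b, c)` of `ℝ³`. -/
def pt (a b c : ℝ) : E3 := (WithLp.equiv 2 (Fin 3 → ℝ)).symm ![a, b, c]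

/-- The vertex `(±1, ±1, ±1)` of the cube indexed by a sign pattern `ε`. -/
def cubeVert (ε : Fin 3 → Bool) : E3 :=
  pt (if ε 0 then 1 else -1) (if ε 1 then 1 else -1) (if ε 2 then 1 else -1)

/-- The electrostatic potential of the eight unit point charges at the vertices
`(±1, ±1, ±1)` of the cube. -/
def Vcube : E3 → ℝ :=
  fun x => ∑ ε : Fin 3 → Bool, 1 / ‖x - cubeVert ε‖

/-- The factor `q ↦ q ^ (-3/2)` by which a charge at squared distance `q` weights its
displacement in the field. -/
def invCube (q : ℝ) : ℝ := (√q)⁻¹ ^ 3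

/-- Half the derivative of the potential along a coordinate at the point `(t, t, 0)`. -/
def edgeField (t : ℝ) : ℝ :=
  (t - 1) * invCube (2 * (1 - t) ^ 2 + 1) + (t + 1) * invCube (2 * (1 + t) ^ 2 + 1) +
    2 * t * invCube (2 * t ^ 2 + 3)

/-- `m` is the midpoint of an edge of the cube. -/
def IsEdgeMidpoint (m : E3) : Prop :=
  ∃ j : Fin 3, m j = 0 ∧ ∀ k : Fin 3, k ≠ j → (m k = 1 ∨ m k = -1)

lemma hasFDerivAt_one_div_norm_sub {v x : E3} (h : x ≠ v) :
    HasFDerivAt (fun y : E3 => 1 / ‖y - v‖)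
      (-(‖x - v‖⁻¹ ^ 3) • innerSL ℝ (x - v)) x := by
  have hn : ‖x - v‖ ≠ 0 := norm_ne_zero_iff.2 (sub_ne_zero.2 h)
  have h1 : HasFDerivAt (fun y : E3 => y - v) (ContinuousLinearMap.id ℝ E3) x :=
    (hasFDerivAt_id x).sub_const v
  have h2 := h1.norm_sq.sqrt (pow_ne_zero 2 hn)
  simp only [Real.sqrt_sq (norm_nonneg _)] at h2
  have h3 := (hasDerivAt_inv hn).comp_hasFDerivAt x h2
  simp only [one_div]
  refine h3.congr_fderiv ?_
  ext y
  simp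
  field_simp

lemma fderiv_Vcube_eq_zero {x : E3} (hx : ∀ ε, x ≠ cubeVert ε)
    (h : ∀ k, ∑ ε : Fin 3 → Bool, (x k - cubeVert ε k) *
      invCube ((x 0 - cubeVert ε 0) ^ 2 + (x 1 - cubeVert ε 1) ^ 2 +
        (x 2 - cubeVert ε 2) ^ 2) = 0) :
    fderiv ℝ Vcube x = 0 := by
  have hnorm : ∀ ε, ‖x - cubeVert ε‖⁻¹ ^ 3 =
      invCube ((x 0 - cubeVert ε 0) ^ 2 + (x 1 - cubeVert ε 1) ^ 2 +
        (x 2 - cubeVert ε 2) ^ 2) := by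
    intro ε
    simp [invCube, EuclideanSpace.norm_eq, Fin.sum_univ_three]
  have hd : HasFDerivAt Vcube (∑ ε : Fin 3 → Bool,
      -(‖x - cubeVert ε‖⁻¹ ^ 3) • innerSL ℝ (x - cubeVert ε)) x :=
    HasFDerivAt.fun_sum fun ε _ => hasFDerivAt_one_div_norm_sub (hx ε)
  rw [hd.fderiv]
  have hsum : ∑ ε : Fin 3 → Bool, (‖x - cubeVert ε‖⁻¹ ^ 3) • (x - cubeVert ε) = 0 := by
    ext k
    simpa [hnorm, mul_comm] using h k
  simp only [neg_smul, Finset.sum_neg_distrib, ← map_smul, ← map_sum, hsum, map_zero, neg_zero]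

lemma smul_ne_cubeVert {m : E3} (hm : IsEdgeMidpoint m) (t : ℝ) (ε : Fin 3 → Bool) :
    t • m ≠ cubeVert ε := by
  obtain ⟨j, hj, -⟩ := hm
  intro h
  have h1 : t * m j = cubeVert ε j := by simpa using congrArg (fun z : E3 => z j) h
  rw [hj, mul_zero] at h1
  fin_cases j <;> simp [cubeVert, pt] at h1 <;> split_ifs at h1 <;> norm_num at h1

lemma sum_sign_patterns (f : (Fin 3 → Bool) → ℝ) :
    ∑ ε, f ε = f ![true, true, true] + f ![true, true, false] + f ![true, false, true] +
      f ![true, false, false] + f ![false, true, true] + f ![false, true, false] +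
      f ![false, false, true] + f ![false, false, false] := by
  have : (Finset.univ : Finset (Fin 3 → Bool)) = {![true, true, true], ![true, true, false],
      ![true, false, true], ![true, false, false], ![false, true, true], ![false, true, false],
      ![false, false, true], ![false, false, false]} := by decide
  rw [this]
  repeat rw [Finset.sum_insert (by decide)]
  rw [Finset.sum_singleton]
  ring

lemma fderiv_Vcube_smul_eq_zero {t : ℝ} (ht : edgeField t = 0) {m : E3}
    (hm : IsEdgeMidpoint m) : fderiv ℝ Vcube (t • m) = 0 := by
  refine fderiv_Vcube_eq_zero (smul_ne_cubeVert hm t) ?_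
  obtain ⟨j, hj, hk⟩ := hm
  unfold edgeField at ht
  ring_nf at ht
  intro k
  rw [sum_sign_patterns]
  have h0 := hk 0
  have h1 := hk 1
  have h2 := hk 2
  fin_cases j <;> simp at hj h0 h1 h2
  · rcases h1 with h1 | h1 <;> rcases h2 with h2 | h2 <;> fin_cases k <;>
      simp [cubeVert, pt, hj, h1, h2] <;> ring_nf <;> linarith
  · rcases h0 with h0 | h0 <;> rcases h2 with h2 | h2 <;> fin_cases k <;>
      simp [cubeVert, pt, hj, h0, h2] <;> ring_nf <;> linarith
  · rcases h0 with h0 | h0 <;> rcases h1 with h1 | h1 <;> fin_cases k <;>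
      simp [cubeVert, pt, hj, h0, h1] <;> ring_nf <;> linarith

lemma continuous_edgeField : Continuous edgeField := by
  have hc : ∀ q : ℝ → ℝ, Continuous q → (∀ t, 0 < q t) → Continuous fun t => invCube (q t) :=
    fun q hq hpos => (hq.sqrt.inv₀ fun t => (Real.sqrt_pos.2 (hpos t)).ne').pow 3
  have h1 := hc (fun t => 2 * (1 - t) ^ 2 + 1) (by fun_prop) (fun t => by positivity)
  have h2 := hc (fun t => 2 * (1 + t) ^ 2 + 1) (by fun_prop) (fun t => by positivity)
  have h3 := hc (fun t => 2 * t ^ 2 + 3) (by fun_prop) (fun t => by positivity)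
  unfold edgeField
  fun_prop

lemma edgeField_half_neg : edgeField (1 / 2) < 0 := by
  have hlow : (0.544 : ℝ) ≤ invCube (3 / 2) := by
    have h : (0.8164 : ℝ) ≤ (√(3 / 2))⁻¹ := by
      rw [← Real.sqrt_inv]
      exact Real.le_sqrt_of_sq_le (by norm_num)
    calc (0.544 : ℝ) ≤ 0.8164 ^ 3 := by norm_num
      _ ≤ _ := by unfold invCube; gcongr
  have hup : ∀ q r : ℝ, 0 ≤ r → q⁻¹ ≤ r ^ 2 → invCube q ≤ r ^ 3 := by
    intro q r hr h
    unfold invCube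
    rw [← Real.sqrt_inv]
    gcongr
    exact Real.sqrt_le_iff.2 ⟨hr, h⟩
  have h2 := hup (11 / 2) 0.4265 (by norm_num) (by norm_num)
  have h3 := hup (7 / 2) 0.5346 (by norm_num) (by norm_num)
  unfold edgeField
  norm_num at *
  linarith

lemma edgeField_one_pos : 0 < edgeField 1 := by
  unfold edgeField invCube
  norm_num
  positivity

lemma exists_edgeField_eq_zero : ∃ t ∈ Set.Ioo (1 / 2 : ℝ) 1, edgeField t = 0 :=
  intermediate_value_Ioo (by norm_num) continuous_edgeField.continuousOn
    ⟨edgeField_half_neg, edgeField_one_pos⟩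

/-- The edge midpoints of the cube, as integer vectors. -/
def edgeMidpoints : Finset (Fin 3 → ℤ) :=
  {z ∈ Fintype.piFinset fun _ => {-1, 0, 1} | ∃ j, z j = 0 ∧ ∀ k, k ≠ j → (z k = 1 ∨ z k = -1)}

lemma card_edgeMidpoints : edgeMidpoints.card = 12 := by decide

lemma smul_intCast_injective {t : ℝ} (ht : t ≠ 0) :
    Function.Injective fun z : Fin 3 → ℤ => t • (WithLp.toLp 2 fun i => (z i : ℝ) : E3) := by
  intro z w h
  ext i
  have h1 := congrArg (fun x : E3 => x i) (smul_right_injective E3 ht h)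
  simpa using h1

/-- for each edge midpoint `m` of the cube (one coordinate `0`, the
other two in `{-1, 1}`), there is `t ∈ (1/2, 1)` with `∇V(t • m) = 0`; in
particular, besides the center there are at least twelve equilibria. -/
theorem stmt13 :
    (∀ m : E3,
      (∃ j : Fin 3, m j = 0 ∧ ∀ k : Fin 3, k ≠ j → (m k = 1 ∨ m k = -1)) →
      ∃ t ∈ Set.Ioo (1 / 2 : ℝ) 1, fderiv ℝ Vcube (t • m) = 0) ∧
    (∃ S : Finset E3, 12 ≤ S.card ∧ ∀ x ∈ S,
      (∀ ε : Fin 3 → Bool, x ≠ cubeVert ε) ∧ x ≠ 0 ∧ fderiv ℝ Vcube x = 0) := by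
  obtain ⟨t, ht, h0⟩ := exists_edgeField_eq_zero
  have htpos : t ≠ 0 := by linarith [ht.1]
  refine ⟨fun m hm => ⟨t, ht, fderiv_Vcube_smul_eq_zero h0 hm⟩,
    edgeMidpoints.map ⟨_, smul_intCast_injective htpos⟩, ?_, ?_⟩
  · rw [Finset.card_map, card_edgeMidpoints]
  · intro x hx
    obtain ⟨z, hz, rfl⟩ := Finset.mem_map.1 hx
    obtain ⟨j, hj, hk⟩ := (Finset.mem_filter.1 hz).2
    have hm : IsEdgeMidpoint (WithLp.toLp 2 fun i => (z i : ℝ)) := by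
      refine ⟨j, by simpa using hj, fun k hkj => ?_⟩
      rcases hk k hkj with h | h <;> simp [h]
    refine ⟨smul_ne_cubeVert hm t, smul_ne_zero htpos fun h => ?_, fderiv_Vcube_smul_eq_zero h0 hm⟩
    obtain ⟨k, hkj⟩ := exists_ne j
    have hzk : z k = 0 := by simpa using congrArg (fun x : E3 => x k) h
    have := hk k hkj
    omega
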